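/- arXiv:1805.07078 — 5 statements merged into one kernel-verified Lean document; each statement's English description precedes it below -/
import Mathlib

section
/- For the basic polar transform, the number of zero-capacity channels is invariant in the following sense: if the 'plus' polarized bit-channel has zero capacity, i.e., U₂ is independent of the triple (U₁,Y₁,Y₂), then both underlying channels have zero capacity, i.e., Y₁ is independent of B₁ and Y₂ is independent of B₂. -/
open MeasureTheory ProbabilityTheory

/-- **Basic polar transform: invariance of the number of zero-capacity channels.**
If the plus polarized bit-channel has zero capacity, i.e. `U₂` is independent of the triple
`(U₁, Y₁, Y₂)`, then both underlying channels have zero capacity: `Y₁` is independent of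
`B₁ = U₁ + U₂` and `Y₂` is independent of `B₂ = U₂`. -/
theorem polar_plus_zero_capacity_iff_both_channels_zero
    {𝒴₁ 𝒴₂ : Type*} [Fintype 𝒴₁] [Fintype 𝒴₂] [Nonempty 𝒴₁] [Nonempty 𝒴₂]
    [MeasurableSpace 𝒴₁] [DiscreteMeasurableSpace 𝒴₁]
    [MeasurableSpace 𝒴₂] [DiscreteMeasurableSpace 𝒴₂]
    (W₁ : ZMod 2 → PMF 𝒴₁) (W₂ : ZMod 2 → PMF 𝒴₂)
    (P : Measure (ZMod 2 × ZMod 2 × 𝒴₁ × 𝒴₂)) [IsProbabilityMeasure P]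
    (hP : ∀ u₁ u₂ : ZMod 2, ∀ y₁ : 𝒴₁, ∀ y₂ : 𝒴₂,
      P {(u₁, u₂, y₁, y₂)} = 4⁻¹ * W₁ (u₁ + u₂) y₁ * W₂ u₂ y₂)
    -- random variables: U₁, U₂, Y₁, Y₂ are coordinate projections; B₁ = U₁+U₂, B₂ = U₂
    (U₁ : ZMod 2 × ZMod 2 × 𝒴₁ × 𝒴₂ → ZMod 2) (hU₁ : U₁ = fun ω => ω.1)
    (U₂ : ZMod 2 × ZMod 2 × 𝒴₁ × 𝒴₂ → ZMod 2) (hU₂ : U₂ = fun ω => ω.2.1)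
    (Y₁ : ZMod 2 × ZMod 2 × 𝒴₁ × 𝒴₂ → 𝒴₁) (hY₁ : Y₁ = fun ω => ω.2.2.1)
    (Y₂ : ZMod 2 × ZMod 2 × 𝒴₁ × 𝒴₂ → 𝒴₂) (hY₂ : Y₂ = fun ω => ω.2.2.2)
    (B₁ : ZMod 2 × ZMod 2 × 𝒴₁ × 𝒴₂ → ZMod 2) (hB₁ : B₁ = fun ω => U₁ ω + U₂ ω)
    (B₂ : ZMod 2 × ZMod 2 × 𝒴₁ × 𝒴₂ → ZMod 2) (hB₂ : B₂ = U₂)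
    (h : IndepFun U₂ (fun ω => (U₁ ω, Y₁ ω, Y₂ ω)) P) :
    IndepFun Y₁ B₁ P ∧ IndepFun Y₂ B₂ P := by
  have hhalf : ∀ u : ZMod 2, P (U₂ ⁻¹' {u}) = 2⁻¹ := by
    intro u
    have h1 : P (U₂ ⁻¹' {u}) = ∑ x, (U₂ ⁻¹' {u}).indicator (fun x => P {x}) x := by
      classical
      rw [Finset.sum_indicator_eq_sum_filter, sum_measure_singleton]
      congr 1
      ext x
      simp
    have s1 : ∀ b, ∑ y, W₁ b y = 1 := fun b => by
      exact (tsum_fintype (L := SummationFilter.unconditional _) _).symm.trans (W₁ b).tsum_coe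
    have s2 : ∀ b, ∑ y, W₂ b y = 1 := fun b => by
      exact (tsum_fintype (L := SummationFilter.unconditional _) _).symm.trans (W₂ b).tsum_coe
    have h2 : ∀ a : ZMod 2, ∑ x : ZMod 2 × 𝒴₁ × 𝒴₂,
        (U₂ ⁻¹' {u}).indicator (fun x => P {x}) (a, x) = 4⁻¹ := by
      intro a
      rw [Fintype.sum_prod_type, Finset.sum_eq_single u]
      · rw [Fintype.sum_prod_type]
        have : ∀ y₁ y₂, (U₂ ⁻¹' {u}).indicator (fun x => P {x}) (a, u, y₁, y₂)
            = 4⁻¹ * W₁ (a + u) y₁ * W₂ u y₂ := by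
          intro y₁ y₂
          rw [Set.indicator_of_mem (by simp [hU₂]), hP]
        simp_rw [this, ← Finset.mul_sum, s2, mul_one, ← Finset.mul_sum, s1, mul_one]
      · intro b _ hb
        refine Finset.sum_eq_zero fun y _ => Set.indicator_of_notMem (by simpa [hU₂] using hb) _
      · simp
    rw [h1, Fintype.sum_prod_type]
    simp_rw [h2]
    rw [Finset.sum_const, Finset.card_univ, ZMod.card, nsmul_eq_mul]
    rw [show (4 : ENNReal) = 2 * 2 by norm_num, ENNReal.mul_inv (by simp) (by simp), ← mul_assoc]
    rw [Nat.cast_ofNat, ENNReal.mul_inv_cancel (by simp) (by simp), one_mul]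
  have key : ∀ (b : ZMod 2) (s : Set 𝒴₁), P (Y₁ ⁻¹' s ∩ B₁ ⁻¹' {b}) = 2⁻¹ * P (Y₁ ⁻¹' s) := by
    intro b s
    have hi := h.measure_inter_preimage_eq_mul
    have split : ∀ A : Set (ZMod 2 × ZMod 2 × 𝒴₁ × 𝒴₂),
        P A = ∑ u : ZMod 2, P (A ∩ U₁ ⁻¹' {u}) := by
      intro A
      rw [← measure_biUnion_finset]
      · congr 1
        ext x
        simp
      · intro i _ j _ hij
        refine Set.disjoint_left.2 fun x hx hy => hij ?_
        exact hx.2.symm.trans hy.2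
      · intro i _
        exact MeasurableSet.of_discrete
    rw [split, split (Y₁ ⁻¹' s), Finset.mul_sum]
    refine Finset.sum_congr rfl fun u _ => ?_
    have := hi {b - u} {t | t.2.1 ∈ s ∧ t.1 = u} MeasurableSet.of_discrete MeasurableSet.of_discrete
    rw [hhalf] at this
    refine Eq.trans ?_ this
    congr 1
    ext x
    simp only [hB₁, Set.mem_inter_iff, Set.mem_preimage, Set.mem_singleton_iff, Set.mem_ofPred_eq]
    constructor
    · rintro ⟨⟨h1, h2⟩, h3⟩
      exact ⟨by rw [← h2, h3]; ring, h1, h3⟩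
    · rintro ⟨h1, h2, h3⟩
      exact ⟨⟨h2, by rw [h1, h3]; ring⟩, h3⟩
  constructor
  · have mY : Measurable Y₁ := Measurable.of_discrete
    have mB : Measurable B₁ := Measurable.of_discrete
    rw [indepFun_iff_map_prod_eq_prod_map_map mY.aemeasurable mB.aemeasurable]
    refine Measure.ext_of_singleton fun ⟨y, b⟩ => ?_
    rw [← Set.singleton_prod_singleton, Measure.prod_prod,
      Measure.map_apply (mY.prodMk mB) MeasurableSet.of_discrete,
      Measure.map_apply mY MeasurableSet.of_discrete,
      Measure.map_apply mB MeasurableSet.of_discrete]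
    have e := key b Set.univ
    rw [Set.preimage_univ, Set.univ_inter, measure_univ, mul_one] at e
    rw [e, mul_comm, ← key]
    rfl
  · rw [hB₂]
    exact (h.comp (φ := id) (ψ := fun t => t.2.2) measurable_id Measurable.of_discrete).symm
end

section
/- For the basic polar transform, the mutual information of the 'minus' bit-channel is at most that of either underlying channel: I⁻ = I(U₁;(Y₁,Y₂)) ≤ min{ I(B₁;Y₁), I(B₂;Y₂) }, where each mutual information I(X;Z) is the Kullback–Leibler divergence from the joint law of (X,Z) under P to the product of the marginal laws of X and Z under P. -/
open MeasureTheory ProbabilityTheory Classical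

/-- Kullback–Leibler divergence between two measures on a finite measurable space with
measurable singletons: `∑ x, μ{x} log (μ{x} / ν{x})` if `μ ≪ ν`, and `∞` otherwise. -/
noncomputable def klDiv {α : Type*} [Fintype α] [MeasurableSpace α]
    (μ ν : Measure α) : EReal :=
  if μ ≪ ν then
    ((∑ x : α, (μ {x}).toReal * Real.log ((μ {x}).toReal / (ν {x}).toReal) : ℝ) : EReal)
  else ⊤

/-- Mutual information `I(X;Z)` of two random variables on `(Ω, P)`: the KL divergence from
the joint law of `(X, Z)` to the product of the marginal laws of `X` and `Z`. -/
noncomputable def mutualInfo {Ω α β : Type*} [Fintype α] [Fintype β]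
    [MeasurableSpace Ω] [MeasurableSpace α] [MeasurableSpace β]
    (P : Measure Ω) (X : Ω → α) (Z : Ω → β) : EReal :=
  klDiv (P.map (fun ω => (X ω, Z ω))) ((P.map X).prod (P.map Z))

lemma polar_tangent {x p T : ℝ} (hx : 0 ≤ x) (hp : 0 ≤ p) (hT : 0 < T) (h : p = 0 → x = 0) :
    x * Real.log T + x - p * T ≤ x * Real.log (x / p) := by
  rcases hx.eq_or_lt with rfl | hx
  · simp; positivity
  have hp' : 0 < p := lt_of_le_of_ne hp (fun e => hx.ne' (h e.symm))
  have h1 := Real.log_le_sub_one_of_pos (show 0 < p * T / x by positivity)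
  rw [Real.log_div (by positivity) (by positivity), Real.log_mul (by positivity) (by positivity)] at h1
  rw [Real.log_div (by positivity) (by positivity)]
  have h2 := mul_le_mul_of_nonneg_left h1 hx.le
  have h3 : x * (p * T / x - 1) = p * T - x := by field_simp
  nlinarith

lemma polar_logsum {x z p q : ℝ} (hx : 0 ≤ x) (hz : 0 ≤ z) (hp : 0 ≤ p) (hq : 0 ≤ q)
    (h : p = 0 → x = 0) (h' : q = 0 → z = 0) :
    (x + z) * Real.log ((x + z) / (p + q)) ≤ x * Real.log (x / p) + z * Real.log (z / q) := by
  rcases (add_nonneg hx hz).eq_or_lt with e | e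
  · have : x = 0 := by linarith
    have hz0 : z = 0 := by linarith
    subst this hz0
    simp
  have hpq : 0 < p + q := by
    rcases (add_nonneg hp hq).eq_or_lt with e' | e'
    · have := h (by linarith)
      have := h' (by linarith)
      linarith
    · exact e'
  have hT : 0 < (x + z) / (p + q) := by positivity
  have h1 := polar_tangent hx hp hT h
  have h2 := polar_tangent hz hq hT h'
  have h3 : (p + q) * ((x + z) / (p + q)) = x + z := by field_simp
  nlinarith

lemma polar_core {a c b d : ℝ} (ha : 0 ≤ a) (hc : 0 ≤ c) (hb : 0 ≤ b) (hd : 0 ≤ d) :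
    (a * b + c * d) * Real.log (2 * (a * b + c * d) / ((a + c) * (b + d))) ≤
      b * (a * Real.log (2 * a / (a + c))) + d * (c * Real.log (2 * c / (a + c))) := by
  have h := polar_logsum (x := a * b) (z := c * d) (p := b * (a + c) / 2) (q := d * (a + c) / 2)
    (by positivity) (by positivity) (by positivity) (by positivity)
    (by
      intro h
      have : b = 0 ∨ a + c = 0 := by simpa using h
      rcases this with h | h
      · simp [h]
      · have : a = 0 := by linarith
        simp [this])
    (by
      intro h
      have : d = 0 ∨ a + c = 0 := by simpa using h
      rcases this with h | h
      · simp [h]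
      · have : c = 0 := by linarith
        simp [this])
  have e1 : (a * b + c * d) / (b * (a + c) / 2 + d * (a + c) / 2)
      = 2 * (a * b + c * d) / ((a + c) * (b + d)) := by
    rw [show b * (a + c) / 2 + d * (a + c) / 2 = ((a + c) * (b + d)) / 2 by ring, div_div_eq_mul_div]
    ring
  have e2 : ∀ s t : ℝ, s * t * Real.log (s * t / (t * (a + c) / 2))
      = t * (s * Real.log (2 * s / (a + c))) := by
    intro s t
    rcases eq_or_ne t 0 with rfl | ht
    · simp
    rw [show s * t / (t * (a + c) / 2) = 2 * s / (a + c) by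
      rw [div_div_eq_mul_div, show s * t * 2 = t * (2 * s) by ring, mul_div_mul_left _ _ ht]]
    ring
  rwa [e1, e2, e2] at h

lemma polar_mi_eq {Ω α β : Type*} [Fintype Ω] [Fintype α] [Fintype β]
    [MeasurableSpace Ω] [MeasurableSpace α] [MeasurableSpace β]
    [DiscreteMeasurableSpace Ω] [DiscreteMeasurableSpace α] [DiscreteMeasurableSpace β]
    (P : Measure Ω) [IsProbabilityMeasure P] (X : Ω → α) (Z : Ω → β) :
    mutualInfo P X Z = ((∑ x : α, ∑ z : β, (P.map (fun ω => (X ω, Z ω)) {(x, z)}).toReal *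
      Real.log ((P.map (fun ω => (X ω, Z ω)) {(x, z)}).toReal /
        ((P.map X {x}).toReal * (P.map Z {z}).toReal)) : ℝ) : EReal) := by
  have hX : Measurable X := Measurable.of_discrete
  have hZ : Measurable Z := Measurable.of_discrete
  have hXZ : Measurable (fun ω => (X ω, Z ω)) := Measurable.of_discrete
  have := Measure.isProbabilityMeasure_map (μ := P) hX.aemeasurable
  have := Measure.isProbabilityMeasure_map (μ := P) hZ.aemeasurable
  have hs : ∀ (x : α) (z : β), ((P.map X).prod (P.map Z)) {(x, z)} = P.map X {x} * P.map Z {z} := by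
    intro x z
    rw [← Set.singleton_prod_singleton, Measure.prod_prod]
  have hac : P.map (fun ω => (X ω, Z ω)) ≪ (P.map X).prod (P.map Z) := by
    intro s hs0
    rw [measure_null_iff_singleton s.to_countable] at hs0 ⊢
    rintro ⟨x, z⟩ hxz
    have h0 := hs0 _ hxz
    rw [hs, mul_eq_zero, Measure.map_apply hX (by measurability),
      Measure.map_apply hZ (by measurability)] at h0
    rw [Measure.map_apply hXZ (by measurability)]
    rcases h0 with h0 | h0 <;> refine measure_mono_null ?_ h0 <;> intro ω hω <;> simp_all
  rw [mutualInfo, klDiv, if_pos hac, Fintype.sum_prod_type]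
  simp only [hs, ENNReal.toReal_mul]

lemma polar_map {Ω α : Type*} [Fintype Ω] [MeasurableSpace Ω] [MeasurableSpace α]
    [DiscreteMeasurableSpace Ω] [DiscreteMeasurableSpace α]
    (P : Measure Ω) [IsProbabilityMeasure P] (X : Ω → α) (x : α) :
    (P.map X {x}).toReal = ∑ ω, if X ω = x then (P {ω}).toReal else 0 := by
  rw [Measure.map_apply Measurable.of_discrete (by measurability)]
  have : X ⁻¹' {x} = ((Finset.univ.filter fun ω => X ω = x : Finset Ω) : Set Ω) := by
    ext; simp
  rw [this, ← sum_measure_singleton, ENNReal.toReal_sum (by simp), Finset.sum_filter]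

lemma polar_pmf {α : Type*} [Fintype α] (p : PMF α) : ∑ y, (p y).toReal = 1 := by
  rw [← ENNReal.toReal_sum (fun a _ => p.apply_ne_top a), ← tsum_fintype (L := .unconditional _),
    p.tsum_coe]
  simp

lemma polar_zsum (f : ZMod 2 → ℝ) : ∑ u, f u = f 0 + f 1 := Fin.sum_univ_two f

/-- Real-valued form of the inequality. -/
lemma polar_real {α β : Type*} [Fintype α] [Fintype β] (a : ZMod 2 → α → ℝ) (b : ZMod 2 → β → ℝ)
    (ha : ∀ x y, 0 ≤ a x y) (hb : ∀ x y, 0 ≤ b x y) (hb1 : ∀ x, ∑ y, b x y = 1) :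
    (∑ u, ∑ y : α × β, ((a u y.1 * b 0 y.2 + a (u + 1) y.1 * b 1 y.2) / 4) *
      Real.log (((a u y.1 * b 0 y.2 + a (u + 1) y.1 * b 1 y.2) / 4) /
        (1 / 2 * ((a 0 y.1 + a 1 y.1) * (b 0 y.2 + b 1 y.2) / 4)))) ≤
    ∑ x, ∑ y, (a x y / 2) * Real.log ((a x y / 2) / (1 / 2 * ((a 0 y + a 1 y) / 2))) := by
  have e1 : ∀ s t : ℝ, (s / 4) / (1 / 2 * (t / 4)) = 2 * s / t := by
    intro s t
    rw [show 1 / 2 * (t / 4) = t / 8 by ring, div_div_eq_mul_div]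
    ring
  have e2 : ∀ s t : ℝ, (s / 2) / (1 / 2 * (t / 2)) = 2 * s / t := by
    intro s t
    rw [show 1 / 2 * (t / 2) = t / 4 by ring, div_div_eq_mul_div]
    ring
  simp only [e1, e2]
  rw [polar_zsum, polar_zsum, ← Finset.sum_add_distrib, ← Finset.sum_add_distrib,
    Fintype.sum_prod_type]
  refine Finset.sum_le_sum fun y _ => ?_
  have h11 : (1 : ZMod 2) + 1 = 0 := by decide
  simp only [zero_add, h11]
  set L := a 0 y * Real.log (2 * a 0 y / (a 0 y + a 1 y)) +
    a 1 y * Real.log (2 * a 1 y / (a 0 y + a 1 y)) with hL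
  have hR : ∑ z, (b 0 z + b 1 z) / 4 * L = L / 2 := by
    rw [← Finset.sum_mul, ← Finset.sum_div, Finset.sum_add_distrib, hb1, hb1]
    ring
  calc _ ≤ ∑ z, (b 0 z + b 1 z) / 4 * L := by
        refine Finset.sum_le_sum fun z _ => ?_
        have h1 := polar_core (ha 0 y) (ha 1 y) (hb 0 z) (hb 1 z)
        have h2 := polar_core (ha 1 y) (ha 0 y) (hb 0 z) (hb 1 z)
        rw [add_comm (a 1 y) (a 0 y)] at h2
        rw [hL]
        linarith
    _ = L / 2 := hR
    _ = _ := by rw [hL]; ring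

/-- **Basic polar transform: the minus bit-channel is worse than either underlying channel.**
`I⁻ = I(U₁;(Y₁,Y₂)) ≤ min { I(B₁;Y₁), I(B₂;Y₂) }`. -/
theorem polar_minus_le_min
    {𝒴₁ 𝒴₂ : Type*} [Fintype 𝒴₁] [Fintype 𝒴₂] [Nonempty 𝒴₁] [Nonempty 𝒴₂]
    [MeasurableSpace 𝒴₁] [DiscreteMeasurableSpace 𝒴₁]
    [MeasurableSpace 𝒴₂] [DiscreteMeasurableSpace 𝒴₂]
    (W₁ : ZMod 2 → PMF 𝒴₁) (W₂ : ZMod 2 → PMF 𝒴₂)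
    (P : Measure (ZMod 2 × ZMod 2 × 𝒴₁ × 𝒴₂)) [IsProbabilityMeasure P]
    (hP : ∀ u₁ u₂ : ZMod 2, ∀ y₁ : 𝒴₁, ∀ y₂ : 𝒴₂,
      P {(u₁, u₂, y₁, y₂)} = 4⁻¹ * W₁ (u₁ + u₂) y₁ * W₂ u₂ y₂)
    -- random variables: U₁, U₂, Y₁, Y₂ are coordinate projections; B₁ = U₁+U₂, B₂ = U₂
    (U₁ : ZMod 2 × ZMod 2 × 𝒴₁ × 𝒴₂ → ZMod 2) (hU₁ : U₁ = fun ω => ω.1)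
    (U₂ : ZMod 2 × ZMod 2 × 𝒴₁ × 𝒴₂ → ZMod 2) (hU₂ : U₂ = fun ω => ω.2.1)
    (Y₁ : ZMod 2 × ZMod 2 × 𝒴₁ × 𝒴₂ → 𝒴₁) (hY₁ : Y₁ = fun ω => ω.2.2.1)
    (Y₂ : ZMod 2 × ZMod 2 × 𝒴₁ × 𝒴₂ → 𝒴₂) (hY₂ : Y₂ = fun ω => ω.2.2.2)
    (B₁ : ZMod 2 × ZMod 2 × 𝒴₁ × 𝒴₂ → ZMod 2) (hB₁ : B₁ = fun ω => U₁ ω + U₂ ω)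
    (B₂ : ZMod 2 × ZMod 2 × 𝒴₁ × 𝒴₂ → ZMod 2) (hB₂ : B₂ = U₂) :
    mutualInfo P U₁ (fun ω => (Y₁ ω, Y₂ ω)) ≤
      min (mutualInfo P B₁ Y₁) (mutualInfo P B₂ Y₂) := by
  subst hU₁ hU₂ hY₁ hY₂
  subst hB₁ hB₂
  set a : ZMod 2 → 𝒴₁ → ℝ := fun x y => (W₁ x y).toReal with hadef
  set b : ZMod 2 → 𝒴₂ → ℝ := fun x y => (W₂ x y).toReal with hbdef
  have ha : ∀ x y, 0 ≤ a x y := fun _ _ => ENNReal.toReal_nonneg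
  have hb : ∀ x y, 0 ≤ b x y := fun _ _ => ENNReal.toReal_nonneg
  have ha1 : ∀ x, ∑ y, a x y = 1 := fun x => polar_pmf _
  have hb1 : ∀ x, ∑ y, b x y = 1 := fun x => polar_pmf _
  have hp : ∀ u v y z, (P {(u, v, y, z)}).toReal = 1 / 4 * a (u + v) y * b v z := by
    intro u v y z
    rw [hP]
    simp [hadef, hbdef, ENNReal.toReal_mul]
  have h11 : (1 : ZMod 2) + 1 = 0 := by decide
  have h01 : (0 : ZMod 2) ≠ 1 := by decide
  have h10 : (1 : ZMod 2) ≠ 0 := by decide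
  have z2 : ∀ u : ZMod 2, u = 0 ∨ u = 1 := by decide
  rw [polar_mi_eq, polar_mi_eq, polar_mi_eq]
  -- masses
  have m1 : ∀ (u : ZMod 2) (y : 𝒴₁ × 𝒴₂),
      (P.map (fun ω => (ω.1, (ω.2.2.1, ω.2.2.2))) {(u, y)}).toReal
        = (a u y.1 * b 0 y.2 + a (u + 1) y.1 * b 1 y.2) / 4 := by
    rintro u ⟨y, z⟩
    rw [polar_map]
    simp only [Fintype.sum_prod_type, hp, Prod.mk.injEq, ite_and, Finset.sum_ite_eq',
      Finset.mem_univ, if_true, polar_zsum, Finset.sum_ite_irrel, Finset.sum_const_zero]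
    rcases z2 u with rfl | rfl <;> simp [h11] <;> ring
  have m2 : ∀ (u : ZMod 2), (P.map (fun ω => ω.1) {u}).toReal = 1 / 2 := by
    intro u
    rw [polar_map]
    simp only [Fintype.sum_prod_type, hp, Finset.sum_ite_irrel, Finset.sum_const_zero,
      ← Finset.mul_sum, hb1, ha1, polar_zsum]
    rcases z2 u with rfl | rfl <;> simp [ha1, ← Finset.mul_sum] <;> norm_num
  have m3 : ∀ (y : 𝒴₁ × 𝒴₂),
      (P.map (fun ω => (ω.2.2.1, ω.2.2.2)) {y}).toReal
        = (a 0 y.1 + a 1 y.1) * (b 0 y.2 + b 1 y.2) / 4 := by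
    rintro ⟨y, z⟩
    rw [polar_map]
    simp only [Fintype.sum_prod_type, hp, Prod.mk.injEq, ite_and, Finset.sum_ite_eq',
      Finset.mem_univ, if_true, polar_zsum, Finset.sum_ite_irrel, Finset.sum_const_zero]
    simp [h11]; ring
  have m4 : ∀ (u : ZMod 2) (y : 𝒴₁),
      (P.map (fun ω => (ω.1 + ω.2.1, ω.2.2.1)) {(u, y)}).toReal = a u y / 2 := by
    intro u y
    rw [polar_map]
    simp only [Fintype.sum_prod_type, hp, Prod.mk.injEq, ite_and, Finset.sum_ite_eq',
      Finset.mem_univ, if_true, polar_zsum, Finset.sum_ite_irrel, Finset.sum_const_zero,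
      ← Finset.mul_sum, hb1]
    rcases z2 u with rfl | rfl <;> simp [h11] <;> ring
  have m5 : ∀ (u : ZMod 2), (P.map (fun ω => ω.1 + ω.2.1) {u}).toReal = 1 / 2 := by
    intro u
    rw [polar_map]
    simp only [Fintype.sum_prod_type, hp, Finset.sum_ite_irrel, Finset.sum_const_zero,
      ← Finset.mul_sum, hb1, ha1, polar_zsum]
    rcases z2 u with rfl | rfl <;> simp [h11, ha1, ← Finset.mul_sum] <;> norm_num
  have m6 : ∀ (y : 𝒴₁), (P.map (fun ω => ω.2.2.1) {y}).toReal = (a 0 y + a 1 y) / 2 := by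
    intro y
    rw [polar_map]
    simp only [Fintype.sum_prod_type, hp, Finset.sum_ite_eq',
      Finset.mem_univ, if_true, polar_zsum, Finset.sum_ite_irrel, Finset.sum_const_zero,
      ← Finset.mul_sum, hb1]
    simp [h11]; ring
  have m7 : ∀ (u : ZMod 2) (z : 𝒴₂),
      (P.map (fun ω => (ω.2.1, ω.2.2.2)) {(u, z)}).toReal = b u z / 2 := by
    intro u z
    rw [polar_map]
    simp only [Fintype.sum_prod_type, hp, Prod.mk.injEq, ite_and, Finset.sum_ite_eq',
      Finset.mem_univ, if_true, polar_zsum, Finset.sum_ite_irrel, Finset.sum_const_zero,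
      ← Finset.mul_sum, ← Finset.sum_mul, ha1]
    rcases z2 u with rfl | rfl <;> simp [ha1, ← Finset.mul_sum, ← Finset.sum_mul] <;> ring
  have m8 : ∀ (u : ZMod 2), (P.map (fun ω => ω.2.1) {u}).toReal = 1 / 2 := by
    intro u
    rw [polar_map]
    simp only [Fintype.sum_prod_type, hp, Finset.sum_ite_irrel, Finset.sum_const_zero,
      ← Finset.mul_sum, hb1, ha1, polar_zsum]
    rcases z2 u with rfl | rfl <;> simp [ha1, ← Finset.mul_sum] <;> norm_num
  have m9 : ∀ (z : 𝒴₂), (P.map (fun ω => ω.2.2.2) {z}).toReal = (b 0 z + b 1 z) / 2 := by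
    intro z
    rw [polar_map]
    simp only [Fintype.sum_prod_type, hp, Finset.sum_ite_eq',
      Finset.mem_univ, if_true, polar_zsum, ← Finset.mul_sum, ← Finset.sum_mul, ha1]
    ring
  simp only [m1, m2, m3, m4, m5, m6, m7, m8, m9]
  refine le_min (EReal.coe_le_coe_iff.2 ?_) (EReal.coe_le_coe_iff.2 ?_)
  · exact polar_real a b ha hb hb1
  · refine le_trans (le_of_eq ?_) (polar_real b a hb ha ha1)
    refine Finset.sum_congr rfl fun u _ => ?_
    refine Fintype.sum_equiv (Equiv.prodComm _ _) _ _ ?_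
    rintro ⟨y, z⟩
    have hS : a u y * b 0 z + a (u + 1) y * b 1 z = b u z * a 0 y + b (u + 1) z * a 1 y := by
      rcases z2 u with rfl | rfl <;> simp [h11] <;> ring
    simp only [Equiv.prodComm_apply, Prod.swap_prod_mk, hS]
    rw [mul_comm (a 0 y + a 1 y)]
end

section
/- For the basic polar transform, the mutual information of the 'plus' bit-channel is at least that of either underlying channel: I⁺ = I(U₂;(U₁,Y₁,Y₂)) ≥ max{ I(B₁;Y₁), I(B₂;Y₂) }, where each mutual information I(X;Z) is the Kullback–Leibler divergence from the joint law of (X,Z) under P to the product of the marginal laws of X and Z under P. -/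
open MeasureTheory ProbabilityTheory Classical

lemma klDiv_eq_it {α : Type*} [Fintype α] [MeasurableSpace α] [DiscreteMeasurableSpace α]
    (μ ν : Measure α) [IsProbabilityMeasure μ] [IsProbabilityMeasure ν] :
    klDiv μ ν = ((InformationTheory.klDiv μ ν : ENNReal) : EReal) := by
  unfold klDiv
  split_ifs with h
  · have hint : Integrable (llr μ ν) μ := Integrable.of_finite
    have hne : InformationTheory.klDiv μ ν ≠ ⊤ := InformationTheory.klDiv_ne_top h hint
    rw [← EReal.coe_ennreal_toReal hne,
      InformationTheory.toReal_klDiv_of_measure_eq h (by simp), integral_fintype hint]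
    congr 1
    refine Finset.sum_congr rfl fun x _ => ?_
    rw [smul_eq_mul, Measure.real]
    by_cases hx : μ {x} = 0
    · simp [hx]
    have hν : ν {x} ≠ 0 := fun h0 => hx (h h0)
    have h1 : μ {x} = μ.rnDeriv ν x * ν {x} := by
      conv_lhs => rw [← Measure.withDensity_rnDeriv_eq μ ν h]
      rw [withDensity_apply _ (MeasurableSet.singleton x)]
      simp [mul_comm]
    congr 2
    rw [h1, ENNReal.toReal_mul, mul_div_assoc, div_self, mul_one]
    exact (ENNReal.toReal_pos hν (measure_ne_top _ _)).ne'
  · rw [InformationTheory.klDiv_of_not_ac h]; rfl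

lemma klDiv_map_le_fin {α β : Type*} [Fintype α] [MeasurableSpace α] [DiscreteMeasurableSpace α]
    [Fintype β] [MeasurableSpace β] [DiscreteMeasurableSpace β]
    (μ ν : Measure α) [IsProbabilityMeasure μ] [IsProbabilityMeasure ν] (g : α → β) :
    klDiv (μ.map g) (ν.map g) ≤ klDiv μ ν := by
  have hg : Measurable g := Measurable.of_discrete
  have := Measure.isProbabilityMeasure_map (μ := μ) hg.aemeasurable
  have := Measure.isProbabilityMeasure_map (μ := ν) hg.aemeasurable
  rw [klDiv_eq_it, klDiv_eq_it]
  exact_mod_cast InformationTheory.klDiv_map_le μ ν hg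

lemma polar_input_prob {𝒴₁ 𝒴₂ : Type*} [Fintype 𝒴₁] [Fintype 𝒴₂]
    [MeasurableSpace 𝒴₁] [DiscreteMeasurableSpace 𝒴₁]
    [MeasurableSpace 𝒴₂] [DiscreteMeasurableSpace 𝒴₂]
    (W₁ : ZMod 2 → PMF 𝒴₁) (W₂ : ZMod 2 → PMF 𝒴₂)
    (P : Measure (ZMod 2 × ZMod 2 × 𝒴₁ × 𝒴₂))
    (hP : ∀ u₁ u₂ : ZMod 2, ∀ y₁ : 𝒴₁, ∀ y₂ : 𝒴₂,
      P {(u₁, u₂, y₁, y₂)} = 4⁻¹ * W₁ (u₁ + u₂) y₁ * W₂ u₂ y₂)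
    (f : ZMod 2 → ZMod 2 → ZMod 2) (b : ZMod 2) :
    P {ω | f ω.1 ω.2.1 = b} = ∑ u₁, ∑ u₂, if f u₁ u₂ = b then 4⁻¹ else 0 := by
  have hs₁ : ∀ u, ∑ y, W₁ u y = 1 := fun u => by
    rw [← tsum_fintype (L := .unconditional _)]; exact (W₁ u).tsum_coe
  have hs₂ : ∀ u, ∑ y, W₂ u y = 1 := fun u => by
    rw [← tsum_fintype (L := .unconditional _)]; exact (W₂ u).tsum_coe
  rw [← lintegral_indicator_one (MeasurableSet.of_discrete), lintegral_fintype]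
  simp only [Fintype.sum_prod_type, hP]
  refine Finset.sum_congr rfl fun u₁ _ => Finset.sum_congr rfl fun u₂ _ => ?_
  by_cases h : f u₁ u₂ = b
  · simp only [Set.indicator, Set.mem_ofPred_eq, h, if_true, Pi.one_apply, one_mul]
    simp only [← Finset.mul_sum, hs₂, mul_one, hs₁]
  · simp [Set.indicator, h]

lemma four_half : (4⁻¹ : ENNReal) + 4⁻¹ = 2⁻¹ := by
  rw [← two_mul, show (4 : ENNReal) = 2 * 2 by norm_num,
    ENNReal.mul_inv (by simp) (by simp), ← mul_assoc, ENNReal.mul_inv_cancel (by simp) (by simp),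
    one_mul]

/-- **Basic polar transform: the plus bit-channel is better than either underlying channel.**
`I⁺ = I(U₂;(U₁,Y₁,Y₂)) ≥ max { I(B₁;Y₁), I(B₂;Y₂) }`. -/
theorem polar_plus_ge_max
    {𝒴₁ 𝒴₂ : Type*} [Fintype 𝒴₁] [Fintype 𝒴₂] [Nonempty 𝒴₁] [Nonempty 𝒴₂]
    [MeasurableSpace 𝒴₁] [DiscreteMeasurableSpace 𝒴₁]
    [MeasurableSpace 𝒴₂] [DiscreteMeasurableSpace 𝒴₂]
    (W₁ : ZMod 2 → PMF 𝒴₁) (W₂ : ZMod 2 → PMF 𝒴₂)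
    (P : Measure (ZMod 2 × ZMod 2 × 𝒴₁ × 𝒴₂)) [IsProbabilityMeasure P]
    (hP : ∀ u₁ u₂ : ZMod 2, ∀ y₁ : 𝒴₁, ∀ y₂ : 𝒴₂,
      P {(u₁, u₂, y₁, y₂)} = 4⁻¹ * W₁ (u₁ + u₂) y₁ * W₂ u₂ y₂)
    -- random variables: U₁, U₂, Y₁, Y₂ are coordinate projections; B₁ = U₁+U₂, B₂ = U₂
    (U₁ : ZMod 2 × ZMod 2 × 𝒴₁ × 𝒴₂ → ZMod 2) (hU₁ : U₁ = fun ω => ω.1)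
    (U₂ : ZMod 2 × ZMod 2 × 𝒴₁ × 𝒴₂ → ZMod 2) (hU₂ : U₂ = fun ω => ω.2.1)
    (Y₁ : ZMod 2 × ZMod 2 × 𝒴₁ × 𝒴₂ → 𝒴₁) (hY₁ : Y₁ = fun ω => ω.2.2.1)
    (Y₂ : ZMod 2 × ZMod 2 × 𝒴₁ × 𝒴₂ → 𝒴₂) (hY₂ : Y₂ = fun ω => ω.2.2.2)
    (B₁ : ZMod 2 × ZMod 2 × 𝒴₁ × 𝒴₂ → ZMod 2) (hB₁ : B₁ = fun ω => U₁ ω + U₂ ω)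
    (B₂ : ZMod 2 × ZMod 2 × 𝒴₁ × 𝒴₂ → ZMod 2) (hB₂ : B₂ = U₂) :
    max (mutualInfo P B₁ Y₁) (mutualInfo P B₂ Y₂) ≤
      mutualInfo P U₂ (fun ω => (U₁ ω, Y₁ ω, Y₂ ω)) := by
  subst hU₁ hU₂ hY₁ hY₂ hB₁ hB₂
  have hu₂ : ∀ u, P.map (fun ω => ω.2.1) {u} = 2⁻¹ := fun u => by
    rw [Measure.map_apply Measurable.of_discrete (MeasurableSet.singleton u)]
    refine (polar_input_prob W₁ W₂ P hP (fun _ u₂ => u₂) u).trans ?_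
    rw [← four_half]; simp only [Finset.sum_ite_eq', Finset.mem_univ, if_true]; exact Fin.sum_univ_two _
  have hb₁ : ∀ u, P.map (fun ω => ω.1 + ω.2.1) {u} = 2⁻¹ := fun u => by
    rw [Measure.map_apply Measurable.of_discrete (MeasurableSet.singleton u)]
    refine (polar_input_prob W₁ W₂ P hP (fun u₁ u₂ => u₁ + u₂) u).trans ?_
    have h2 : ∀ v : ZMod 2, (∑ u₂, if v + u₂ = u then (4⁻¹ : ENNReal) else 0) = 4⁻¹ := fun v => by
      simp [← eq_sub_iff_add_eq']
    simp only [h2]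
    rw [← four_half]; exact Fin.sum_univ_two _
  have := Measure.isProbabilityMeasure_map (μ := P) (f := fun ω => ω.2.1)
    (Measurable.of_discrete).aemeasurable
  have := Measure.isProbabilityMeasure_map (μ := P) (f := fun ω => (ω.1, ω.2.2.1, ω.2.2.2))
    (Measurable.of_discrete).aemeasurable
  have := Measure.isProbabilityMeasure_map (μ := P) (f := fun ω => (ω.2.1, (ω.1, ω.2.2.1, ω.2.2.2)))
    (Measurable.of_discrete).aemeasurable
  have := Measure.isProbabilityMeasure_map (μ := P) (f := fun ω => ω.1 + ω.2.1)
    (Measurable.of_discrete).aemeasurable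
  have := Measure.isProbabilityMeasure_map (μ := P) (f := fun ω => ω.2.2.1)
    (Measurable.of_discrete).aemeasurable
  have := Measure.isProbabilityMeasure_map (μ := P) (f := fun ω => ω.2.2.2)
    (Measurable.of_discrete).aemeasurable
  unfold mutualInfo
  refine max_le ?_ ?_
  · refine le_trans (le_of_eq ?_) (klDiv_map_le_fin _ _
      (fun x : ZMod 2 × ZMod 2 × 𝒴₁ × 𝒴₂ => (x.2.1 + x.1, x.2.2.1)))
    congr 1
    · rw [Measure.map_map Measurable.of_discrete Measurable.of_discrete]; rfl
    · refine Measure.ext_of_singleton fun ⟨b, y⟩ => ?_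
      rw [← Set.singleton_prod_singleton, Measure.prod_prod, hb₁,
        Measure.map_apply Measurable.of_discrete (MeasurableSet.of_discrete),
        Measure.map_apply Measurable.of_discrete (MeasurableSet.of_discrete),
        Measure.prod_apply (MeasurableSet.of_discrete), lintegral_fintype]
      simp only [hu₂, ← Finset.sum_mul]
      rw [mul_comm]
      congr 1
      have h3 : ∀ u : ZMod 2, (P.map (fun ω => (ω.1, ω.2.2.1, ω.2.2.2)))
          (Prod.mk u ⁻¹' ((fun x : ZMod 2 × ZMod 2 × 𝒴₁ × 𝒴₂ => (x.2.1 + x.1, x.2.2.1)) ⁻¹'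
            ({b} ×ˢ {y}))) = P {ω | ω.2.2.1 = y ∧ b - ω.1 = u} := fun u => by
        rw [Measure.map_apply Measurable.of_discrete (MeasurableSet.of_discrete)]
        congr 1
        ext ω
        simp only [Set.mem_preimage, Set.mem_prod, Set.mem_singleton_iff, Set.mem_ofPred_eq,
          sub_eq_iff_eq_add']
        exact ⟨fun ⟨h, h'⟩ => ⟨h', h.symm⟩, fun ⟨h, h'⟩ => ⟨h'.symm, h⟩⟩
      simp only [h3]
      rw [← measure_biUnion_finset]
      · congr 1
        ext ω
        simp
      · intro u _ v _ huv
        refine Set.disjoint_left.2 fun ω h h' => huv (h.2.symm.trans h'.2)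
      · exact fun _ _ => MeasurableSet.of_discrete
  · refine le_trans (le_of_eq ?_) (klDiv_map_le_fin _ _
      (fun x : ZMod 2 × ZMod 2 × 𝒴₁ × 𝒴₂ => (x.1, x.2.2.2)))
    congr 1
    · rw [Measure.map_map Measurable.of_discrete Measurable.of_discrete]; rfl
    · have h := Measure.map_prod_map (P.map (fun ω => ω.2.1))
        (P.map (fun ω => (ω.1, ω.2.2.1, ω.2.2.2)))
        (f := id) (g := fun z : ZMod 2 × 𝒴₁ × 𝒴₂ => z.2.2)
        Measurable.of_discrete Measurable.of_discrete
      rw [Measure.map_map Measurable.of_discrete Measurable.of_discrete,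
        Measure.map_map Measurable.of_discrete Measurable.of_discrete] at h
      exact h
end

section
/- For the basic polar transform, mutual information is conserved: I(U₁;(Y₁,Y₂)) + I(U₂;(U₁,Y₁,Y₂)) = I(B₁;Y₁) + I(B₂;Y₂), i.e., the sum of the capacities of the two polarized bit-channels equals the sum of the capacities of the two underlying channels. -/
open MeasureTheory ProbabilityTheory Classical

/-- The real probability that `F = a`, as a finite sum. -/
lemma polar_real_map {Ω α : Type*} [Fintype Ω] [MeasurableSpace Ω] [DiscreteMeasurableSpace Ω]
    [MeasurableSpace α] [DiscreteMeasurableSpace α]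
    (P : Measure Ω) [IsProbabilityMeasure P] (F : Ω → α) (a : α) :
    (P.map F {a}).toReal = ∑ ω, if F ω = a then (P {ω}).toReal else 0 := by
  rw [Measure.map_apply (Measurable.of_discrete) (MeasurableSet.of_discrete)]
  have h : F ⁻¹' {a} = ((Finset.univ.filter (fun ω => F ω = a) : Finset Ω) : Set Ω) := by
    ext ω; simp
  rw [h, ← sum_measure_singleton, ENNReal.toReal_sum (fun ω _ => measure_ne_top P _),
    Finset.sum_filter]

lemma polar_sum_map {Ω α : Type*} [Fintype Ω] [MeasurableSpace Ω] [DiscreteMeasurableSpace Ω]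
    [Fintype α] [MeasurableSpace α] [DiscreteMeasurableSpace α]
    (P : Measure Ω) [IsProbabilityMeasure P] (F : Ω → α) (g : α → ℝ) :
    ∑ a, (P.map F {a}).toReal * g a = ∑ ω, (P {ω}).toReal * g (F ω) := by
  simp_rw [polar_real_map, Finset.sum_mul]
  rw [Finset.sum_comm]
  refine Finset.sum_congr rfl fun ω _ => ?_
  simp [ite_mul]

lemma polar_mutualInfo_eq {Ω α β : Type*} [Fintype Ω] [MeasurableSpace Ω]
    [DiscreteMeasurableSpace Ω]
    [Fintype α] [MeasurableSpace α] [DiscreteMeasurableSpace α]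
    [Fintype β] [MeasurableSpace β] [DiscreteMeasurableSpace β]
    (P : Measure Ω) [IsProbabilityMeasure P] (X : Ω → α) (Z : Ω → β) :
    mutualInfo P X Z = ((∑ ω, (P {ω}).toReal * Real.log
      ((P.map (fun ω => (X ω, Z ω)) {(X ω, Z ω)}).toReal /
        ((P.map X {X ω}).toReal * (P.map Z {Z ω}).toReal)) : ℝ) : EReal) := by
  have hX : Measurable X := Measurable.of_discrete
  have hZ : Measurable Z := Measurable.of_discrete
  have : IsProbabilityMeasure (P.map X) := Measure.isProbabilityMeasure_map hX.aemeasurable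
  have : IsProbabilityMeasure (P.map Z) := Measure.isProbabilityMeasure_map hZ.aemeasurable
  have hprod : ∀ x : α × β, ((P.map X).prod (P.map Z)) {x} = P.map X {x.1} * P.map Z {x.2} := by
    intro x
    rw [← Measure.prod_prod, Set.singleton_prod_singleton]
  have hac : P.map (fun ω => (X ω, Z ω)) ≪ (P.map X).prod (P.map Z) := by
    intro s hs
    rw [Measure.map_apply Measurable.of_discrete MeasurableSet.of_discrete]
    have hsing : ∀ x ∈ s, P ((fun ω => (X ω, Z ω)) ⁻¹' {x}) = 0 := by
      intro x hx
      have h0 : ((P.map X).prod (P.map Z)) {x} = 0 :=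
        measure_mono_null (Set.singleton_subset_iff.2 hx) hs
      rw [hprod, mul_eq_zero, Measure.map_apply hX MeasurableSet.of_discrete,
        Measure.map_apply hZ MeasurableSet.of_discrete] at h0
      rcases h0 with h0 | h0
      · refine measure_mono_null ?_ h0
        intro ω hω
        simp only [Set.mem_preimage, Set.mem_singleton_iff] at hω ⊢
        rw [← hω]
      · refine measure_mono_null ?_ h0
        intro ω hω
        simp only [Set.mem_preimage, Set.mem_singleton_iff] at hω ⊢
        rw [← hω]
    have hs' : (fun ω => (X ω, Z ω)) ⁻¹' s = ⋃ x ∈ s, (fun ω => (X ω, Z ω)) ⁻¹' {x} := by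
      ext ω; simp
    rw [hs', measure_biUnion_null_iff (Set.to_countable s)]
    exact hsing
  rw [mutualInfo, klDiv, if_pos hac]
  rw [polar_sum_map P (fun ω => (X ω, Z ω)) (fun x => Real.log
    ((P.map (fun ω => (X ω, Z ω)) {x}).toReal / ((P.map X).prod (P.map Z) {x}).toReal))]
  simp_rw [hprod, ENNReal.toReal_mul]

lemma polar_sum_pmf {α : Type*} [Fintype α] (p : PMF α) : ∑ a, (p a).toReal = 1 := by
  rw [← ENNReal.toReal_sum (fun a _ => p.apply_ne_top a)]
  have h := p.tsum_coe
  rw [tsum_fintype] at h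
  simp [h]

lemma polar_sum_zmod (f : ZMod 2 → ℝ) : ∑ x, f x = f 0 + f 1 := Fin.sum_univ_two f

lemma polar_one_add_one : (1 + 1 : ZMod 2) = 0 := rfl

lemma polar_cases (x : ZMod 2) : x = 0 ∨ x = 1 := by revert x; decide

/-- **Basic polar transform: conservation of mutual information.**
`I(U₁;(Y₁,Y₂)) + I(U₂;(U₁,Y₁,Y₂)) = I(B₁;Y₁) + I(B₂;Y₂)`: the sum of the capacities of the
two polarized bit-channels equals the sum of the capacities of the two underlying channels. -/
theorem polar_mutual_information_conservation
    {𝒴₁ 𝒴₂ : Type*} [Fintype 𝒴₁] [Fintype 𝒴₂] [Nonempty 𝒴₁] [Nonempty 𝒴₂]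
    [MeasurableSpace 𝒴₁] [DiscreteMeasurableSpace 𝒴₁]
    [MeasurableSpace 𝒴₂] [DiscreteMeasurableSpace 𝒴₂]
    (W₁ : ZMod 2 → PMF 𝒴₁) (W₂ : ZMod 2 → PMF 𝒴₂)
    (P : Measure (ZMod 2 × ZMod 2 × 𝒴₁ × 𝒴₂)) [IsProbabilityMeasure P]
    (hP : ∀ u₁ u₂ : ZMod 2, ∀ y₁ : 𝒴₁, ∀ y₂ : 𝒴₂,
      P {(u₁, u₂, y₁, y₂)} = 4⁻¹ * W₁ (u₁ + u₂) y₁ * W₂ u₂ y₂)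
    -- random variables: U₁, U₂, Y₁, Y₂ are coordinate projections; B₁ = U₁+U₂, B₂ = U₂
    (U₁ : ZMod 2 × ZMod 2 × 𝒴₁ × 𝒴₂ → ZMod 2) (hU₁ : U₁ = fun ω => ω.1)
    (U₂ : ZMod 2 × ZMod 2 × 𝒴₁ × 𝒴₂ → ZMod 2) (hU₂ : U₂ = fun ω => ω.2.1)
    (Y₁ : ZMod 2 × ZMod 2 × 𝒴₁ × 𝒴₂ → 𝒴₁) (hY₁ : Y₁ = fun ω => ω.2.2.1)
    (Y₂ : ZMod 2 × ZMod 2 × 𝒴₁ × 𝒴₂ → 𝒴₂) (hY₂ : Y₂ = fun ω => ω.2.2.2)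
    (B₁ : ZMod 2 × ZMod 2 × 𝒴₁ × 𝒴₂ → ZMod 2) (hB₁ : B₁ = fun ω => U₁ ω + U₂ ω)
    (B₂ : ZMod 2 × ZMod 2 × 𝒴₁ × 𝒴₂ → ZMod 2) (hB₂ : B₂ = U₂) :
    mutualInfo P U₁ (fun ω => (Y₁ ω, Y₂ ω)) + mutualInfo P U₂ (fun ω => (U₁ ω, Y₁ ω, Y₂ ω)) =
      mutualInfo P B₁ Y₁ + mutualInfo P B₂ Y₂ := by
  subst hB₂ hB₁ hU₁ hU₂ hY₁ hY₂
  rw [polar_mutualInfo_eq, polar_mutualInfo_eq, polar_mutualInfo_eq, polar_mutualInfo_eq,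
    ← EReal.coe_add, ← EReal.coe_add, ← Finset.sum_add_distrib, ← Finset.sum_add_distrib]
  congr 1
  refine Finset.sum_congr rfl fun ω _ => ?_
  obtain ⟨u₁, u₂, y₁, y₂⟩ := ω
  rw [← mul_add, ← mul_add]
  have hp : ∀ u₁ u₂ : ZMod 2, ∀ y₁ : 𝒴₁, ∀ y₂ : 𝒴₂, (P {(u₁, u₂, y₁, y₂)}).toReal
      = (1/4) * (W₁ (u₁ + u₂) y₁).toReal * (W₂ u₂ y₂).toReal := by
    intro a b c d
    rw [hP]; simp [ENNReal.toReal_mul]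
  by_cases h0 : (P {(u₁, u₂, y₁, y₂)}).toReal = 0
  · simp [h0]
  congr 1
  -- sums over the outputs
  have S1 : ∀ b, ∑ y, (W₁ b y).toReal = 1 := fun b => polar_sum_pmf _
  have S2 : ∀ b, ∑ y, (W₂ b y).toReal = 1 := fun b => polar_sum_pmf _
  have eU1 : (P.map (fun ω => ω.1) {u₁}).toReal = 1/2 := by
    rw [polar_real_map]
    simp only [Fintype.sum_prod_type, hp, polar_sum_zmod]
    rcases polar_cases u₁ with rfl | rfl <;>
      simp [← Finset.mul_sum, S1, S2, polar_one_add_one] <;> norm_num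
  have eU2 : (P.map (fun ω => ω.2.1) {u₂}).toReal = 1/2 := by
    rw [polar_real_map]
    simp only [Fintype.sum_prod_type, hp, polar_sum_zmod]
    rcases polar_cases u₂ with rfl | rfl <;>
      simp [← Finset.mul_sum, S1, S2, polar_one_add_one] <;> norm_num
  have eB1 : (P.map (fun ω => ω.1 + ω.2.1) {u₁ + u₂}).toReal = 1/2 := by
    rw [polar_real_map]
    simp only [Fintype.sum_prod_type, hp, polar_sum_zmod]
    rcases polar_cases (u₁ + u₂) with h | h <;> rw [h] <;>
      simp [← Finset.mul_sum, S1, S2, polar_one_add_one] <;> norm_num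
  have eY1 : (P.map (fun ω => ω.2.2.1) {y₁}).toReal
      = ((W₁ 0 y₁).toReal + (W₁ 1 y₁).toReal) / 2 := by
    rw [polar_real_map]
    simp only [Fintype.sum_prod_type, hp, polar_sum_zmod]
    simp [← Finset.mul_sum, ← Finset.sum_mul, S1, S2, polar_one_add_one, Finset.sum_ite_irrel]
    ring
  have eY2 : (P.map (fun ω => ω.2.2.2) {y₂}).toReal
      = ((W₂ 0 y₂).toReal + (W₂ 1 y₂).toReal) / 2 := by
    rw [polar_real_map]
    simp only [Fintype.sum_prod_type, hp, polar_sum_zmod]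
    simp [← Finset.mul_sum, ← Finset.sum_mul, S1, S2, polar_one_add_one]
    ring
  have eYY : (P.map (fun ω => (ω.2.2.1, ω.2.2.2)) {(y₁, y₂)}).toReal
      = ((W₁ 0 y₁).toReal + (W₁ 1 y₁).toReal) / 2
        * (((W₂ 0 y₂).toReal + (W₂ 1 y₂).toReal) / 2) := by
    rw [polar_real_map]
    simp only [Fintype.sum_prod_type, hp, polar_sum_zmod]
    simp [polar_one_add_one, Prod.mk.injEq, ite_and]
    ring
  have eBY1 : (P.map (fun ω => (ω.1 + ω.2.1, ω.2.2.1)) {(u₁ + u₂, y₁)}).toReal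
      = (W₁ (u₁ + u₂) y₁).toReal / 2 := by
    rw [polar_real_map]
    simp only [Fintype.sum_prod_type, hp, polar_sum_zmod]
    rcases polar_cases (u₁ + u₂) with h | h <;> rw [h] <;>
      simp [← Finset.mul_sum, S1, S2, polar_one_add_one, Prod.mk.injEq, Finset.sum_ite_irrel] <;> ring
  have eBY2 : (P.map (fun ω => (ω.2.1, ω.2.2.2)) {(u₂, y₂)}).toReal
      = (W₂ u₂ y₂).toReal / 2 := by
    rw [polar_real_map]
    simp only [Fintype.sum_prod_type, hp, polar_sum_zmod]
    rcases polar_cases u₂ with rfl | rfl <;>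
      simp [← Finset.mul_sum, ← Finset.sum_mul, S1, S2, polar_one_add_one, Prod.mk.injEq] <;> ring
  have eUUYY : (P.map (fun ω => (ω.2.1, ω.1, ω.2.2.1, ω.2.2.2)) {(u₂, u₁, y₁, y₂)}).toReal
      = (P {(u₁, u₂, y₁, y₂)}).toReal := by
    rw [Measure.map_apply Measurable.of_discrete MeasurableSet.of_discrete]
    congr 2
    ext ⟨a, b, c, d⟩
    simp only [Set.mem_preimage, Set.mem_singleton_iff, Prod.mk.injEq]
    tauto
  -- the law of `(U₁, Y₁, Y₂)` charges our point
  have hne : (P.map (fun ω => (ω.1, ω.2.2.1, ω.2.2.2)) {(u₁, y₁, y₂)}).toReal ≠ 0 := by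
    rw [polar_real_map]
    refine (Finset.sum_pos' (fun ω _ => ?_) ⟨(u₁, u₂, y₁, y₂), Finset.mem_univ _, ?_⟩).ne'
    · split_ifs <;> positivity
    · simpa using lt_of_le_of_ne ENNReal.toReal_nonneg (Ne.symm h0)
  dsimp only
  rw [eU1, eU2, eB1, eY1, eY2, eYY, eBY1, eBY2, eUUYY]
  have hw : (W₁ (u₁ + u₂) y₁).toReal ≠ 0 ∧ (W₂ u₂ y₂).toReal ≠ 0 := by
    rw [hp] at h0
    constructor <;> intro h <;> simp [h] at h0
  have q1 : 0 < (W₁ 0 y₁).toReal + (W₁ 1 y₁).toReal := by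
    have a0 : 0 ≤ (W₁ 0 y₁).toReal := ENNReal.toReal_nonneg
    have a1 : 0 ≤ (W₁ 1 y₁).toReal := ENNReal.toReal_nonneg
    have h := lt_of_le_of_ne ENNReal.toReal_nonneg (Ne.symm hw.1)
    rcases polar_cases (u₁ + u₂) with e | e <;> rw [e] at h <;> linarith
  have q2 : 0 < (W₂ 0 y₂).toReal + (W₂ 1 y₂).toReal := by
    have a0 : 0 ≤ (W₂ 0 y₂).toReal := ENNReal.toReal_nonneg
    have a1 : 0 ≤ (W₂ 1 y₂).toReal := ENNReal.toReal_nonneg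
    have h := lt_of_le_of_ne ENNReal.toReal_nonneg (Ne.symm hw.2)
    rcases polar_cases u₂ with e | e <;> rw [e] at h <;> linarith
  rw [hp]
  obtain ⟨w1, w2⟩ := hw
  generalize (P.map (fun ω => (ω.1, ω.2.2.1, ω.2.2.2)) {(u₁, y₁, y₂)}).toReal = r at *
  generalize (W₁ 0 y₁).toReal + (W₁ 1 y₁).toReal = s at *
  generalize (W₂ 0 y₂).toReal + (W₂ 1 y₂).toReal = t at *
  have q1' := q1.ne'
  have q2' := q2.ne'
  rw [← Real.log_mul (by positivity) (by positivity), ← Real.log_mul (by positivity) (by positivity)]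
  congr 1
  field_simp
  norm_num
end

section
/- (Theorem 1.) For an (n,k,N) QUP-polar code, the first N−n bits of the input vector u₁^N are frozen, i.e., carry no information: let N = 2^m, 0 < n ≤ N, let U be uniformly distributed on the space of row vectors (Fin N → ZMod 2), let C = U·G_m be the polar codeword, and let the channel outputs be given by Y_j drawn from W_j(C_j) for the transmitted positions j ∈ {N−n+1,…,N} (conditionally independent given C), where W_j : ZMod 2 → PMF 𝒴 and 𝒴 is a finite type; the punctured positions C₁,…,C_{N−n} produce no output. Then for every i ≤ N−n, the bit U_i is conditionally independent of the output vector (Y_{N−n+1},…,Y_N) given (U₁,…,U_{i−1}); equivalently, the bit-channel mutual information I(U_i; Y_{N−n+1}…Y_N | U₁^{i−1}) is zero. -/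
open MeasureTheory ProbabilityTheory

/-- The polar transform matrix `G_m = F^{⊗m}` of size `2^m` over `GF(2)`, defined recursively
by `G₀ = (1)` and `G_{s+1} = fromBlocks G_s 0 G_s G_s`, under the order-compatible
identification `Fin (2^s) ⊕ Fin (2^s) ≃ Fin (2^(s+1))`. -/
def polarG : (m : ℕ) → Matrix (Fin (2 ^ m)) (Fin (2 ^ m)) (ZMod 2)
  | 0 => 1
  | m + 1 =>
    Matrix.reindex (finSumFinEquiv.trans (finCongr (by ring)))
      (finSumFinEquiv.trans (finCongr (by ring)))
      (Matrix.fromBlocks (polarG m) 0 (polarG m) (polarG m))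

/-- The polar matrix is lower triangular. -/
lemma polarG_lower (m : ℕ) : ∀ a b : Fin (2 ^ m), a < b → polarG m a b = 0 := by
  induction m with
  | zero =>
    intro a b h
    exact absurd h (by have := a.2; have := b.2; simp only [pow_zero] at *; omega)
  | succ m ih =>
    intro a b h
    obtain ⟨a', rfl⟩ := (finSumFinEquiv.trans
      (finCongr (by ring : 2 ^ m + 2 ^ m = 2 ^ (m + 1)))).surjective a
    obtain ⟨b', rfl⟩ := (finSumFinEquiv.trans
      (finCongr (by ring : 2 ^ m + 2 ^ m = 2 ^ (m + 1)))).surjective b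
    rw [polarG, Matrix.reindex_apply, Matrix.submatrix_apply, Equiv.symm_apply_apply,
      Equiv.symm_apply_apply]
    rw [Fin.lt_def] at h
    rcases a' with a | a <;> rcases b' with b | b <;>
      simp only [Matrix.fromBlocks_apply₁₁, Matrix.fromBlocks_apply₁₂,
        Matrix.fromBlocks_apply₂₁, Matrix.fromBlocks_apply₂₂] <;>
      simp at h ⊢
    · exact ih a b h
    · have := a.2; have := b.2; omega
    · exact ih a b h

/-- If `f` is independent of `g` and a sub-sigma-algebra jointly, then `f` and `g` are
conditionally independent given that sub-sigma-algebra. -/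
lemma condIndepFun_of_joint {Ω β γ : Type*} (m' : MeasurableSpace Ω)
    [mΩ : MeasurableSpace Ω] [StandardBorelSpace Ω]
    [MeasurableSpace β] [MeasurableSpace γ] (P : Measure Ω) [IsProbabilityMeasure P]
    (hm' : m' ≤ mΩ) (f : Ω → β) (g : Ω → γ)
    (hf : Measurable f) (hg : Measurable g)
    (h : ∀ s t A, MeasurableSet s → MeasurableSet t → MeasurableSet[m'] A →
      P (f ⁻¹' s ∩ (g ⁻¹' t ∩ A)) = P (f ⁻¹' s) * P (g ⁻¹' t ∩ A)) :
    CondIndepFun m' hm' f g P := by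
  rw [condIndepFun_iff_condExp_inter_preimage_eq_mul hf hg]
  have key : ∀ s t, MeasurableSet s → MeasurableSet t →
      (fun ω => P.real (f ⁻¹' s) * (P⟦g ⁻¹' t | m'⟧) ω) =ᵐ[P] P⟦f ⁻¹' s ∩ g ⁻¹' t | m'⟧ := by
    intro s t hs ht
    have hfs := hf hs
    have hgt := hg ht
    refine ae_eq_condExp_of_forall_setIntegral_eq hm'
      ((integrable_const (1 : ℝ)).indicator (hfs.inter hgt))
      (fun A _ _ => (integrable_condExp.const_mul _).integrableOn) (fun A hA _ => ?_)
      (stronglyMeasurable_condExp.const_mul _).aestronglyMeasurable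
    rw [integral_const_mul, setIntegral_condExp hm'
      ((integrable_const (1 : ℝ)).indicator hgt) hA,
      integral_indicator hgt, integral_indicator (hfs.inter hgt)]
    simp only [integral_const, smul_eq_mul, mul_one, measureReal_restrict_apply_univ,
      measureReal_restrict_apply, MeasurableSet.univ, Set.univ_inter,
      measureReal_restrict_apply hgt, measureReal_restrict_apply (hfs.inter hgt)]
    rw [Set.inter_assoc]
    simp only [measureReal_def]
    rw [h s t A hs ht hA, ENNReal.toReal_mul]
  intro s t hs ht
  have h1 := key s t hs ht
  have h2 := key s Set.univ hs MeasurableSet.univ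
  have h3 : P⟦g ⁻¹' Set.univ | m'⟧ = fun _ => (1 : ℝ) := by
    rw [Set.preimage_univ, Set.indicator_univ]
    exact condExp_const hm' 1
  rw [h3, Set.preimage_univ, Set.inter_univ] at h2
  filter_upwards [h1, h2] with ω h1 h2
  rw [← h1, ← h2, mul_one]

/-- A bit flipped by a measure-preserving map is independent of every invariant event. -/
lemma bit_indep {Ω : Type*} [MeasurableSpace Ω] (P : Measure Ω)
    [IsProbabilityMeasure P] (f : Ω → ZMod 2) (hf : Measurable f) (T : Ω → Ω)
    (hT : MeasurePreserving T P P) (hfT : ∀ ω, f (T ω) = f ω + 1)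
    (s : Set (ZMod 2)) (E : Set Ω) (hE : MeasurableSet E) (hTE : T ⁻¹' E = E) :
    P (f ⁻¹' s ∩ E) = P (f ⁻¹' s) * P E := by
  have hs : ∀ s : Set (ZMod 2), MeasurableSet s := fun s => trivial
  have half : ∀ E : Set Ω, MeasurableSet E → T ⁻¹' E = E → ∀ a : ZMod 2,
      P (f ⁻¹' {a} ∩ E) = 2⁻¹ * P E := by
    intro E hE hTE a
    have e1 : P (f ⁻¹' {a + 1} ∩ E) = P (f ⁻¹' {a} ∩ E) := by
      rw [← hT.measure_preimage ((hf (hs _)).inter hE).nullMeasurableSet, Set.preimage_inter, hTE]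
      congr 2
      ext ω
      simp [hfT]
    have e2 : P (f ⁻¹' {a} ∩ E) + P (f ⁻¹' {a + 1} ∩ E) = P E := by
      rw [← measure_inter_add_sdiff E (hf (hs {a})), Set.inter_comm E]
      congr 2
      ext ω
      have : ∀ x a : ZMod 2, x = a + 1 ↔ x ≠ a := by decide
      simp [this, and_comm]
    rw [e1, ← two_mul] at e2
    rw [← e2, ← mul_assoc, ENNReal.inv_mul_cancel (by simp) (by simp), one_mul]
  have single : ∀ a : ZMod 2, P (f ⁻¹' {a} ∩ E) = P (f ⁻¹' {a}) * P E := by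
    intro a
    have := half Set.univ MeasurableSet.univ rfl a
    rw [Set.inter_univ, measure_univ, mul_one] at this
    rw [half E hE hTE, this]
  have cases : s = ∅ ∨ s = Set.univ ∨ ∃ a, s = {a} := by
    have h2 : ∀ x : ZMod 2, x = 0 ∨ x = 1 := by decide
    by_cases h0 : (0 : ZMod 2) ∈ s <;> by_cases h1 : (1 : ZMod 2) ∈ s
    · right; left; ext x; rcases h2 x with rfl | rfl <;> simp [h0, h1]
    · right; right; refine ⟨0, ?_⟩; ext x; rcases h2 x with rfl | rfl <;> simp [h0, h1]
    · right; right; refine ⟨1, ?_⟩; ext x; rcases h2 x with rfl | rfl <;> simp [h0, h1]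
    · left; ext x; rcases h2 x with rfl | rfl <;> simp [h0, h1]
  rcases cases with rfl | rfl | ⟨a, rfl⟩
  · simp
  · simp
  · exact single a

/-- **Theorem 1: for an `(n, k, N)` QUP-polar code the first `N − n` input bits are frozen.**
Let `N = 2^m`, `0 < n ≤ N`.  The input vector `U` is uniform on `Fin N → ZMod 2`, the codeword
is `C = U ⬝ G_m`, and only the last `n` codeword bits (positions `j` with `N - n ≤ j`,
0-indexed) are transmitted through the memoryless channels `W_j : ZMod 2 → PMF 𝒴`,
producing outputs `Y_j` that are conditionally independent given `C`: the joint probability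
mass function is `P(u, y) = 2^{-N} ∏_{j : N-n ≤ j} W_j((u ⬝ G_m)_j)(y_j)`.  Then for every
`i < N - n` (0-indexed, i.e. every one of the first `N − n` input bits), `U_i` is
conditionally independent of the received output vector given `(U_0, …, U_{i-1})`;
equivalently the bit-channel mutual information `I(U_i; Y | U_0^{i-1})` is zero. -/
theorem qup_first_bits_frozen
    {𝒴 : Type} [Fintype 𝒴] [Nonempty 𝒴] [MeasurableSpace 𝒴] [DiscreteMeasurableSpace 𝒴]
    (m n : ℕ) (hn : 0 < n) (hnN : n ≤ 2 ^ m)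
    (W : Fin (2 ^ m) → ZMod 2 → PMF 𝒴)
    (P : Measure ((Fin (2 ^ m) → ZMod 2) × ({j : Fin (2 ^ m) // 2 ^ m - n ≤ (j : ℕ)} → 𝒴)))
    [IsProbabilityMeasure P]
    (hP : ∀ (u : Fin (2 ^ m) → ZMod 2) (y : {j : Fin (2 ^ m) // 2 ^ m - n ≤ (j : ℕ)} → 𝒴),
      P {(u, y)} = 2⁻¹ ^ (2 ^ m) *
        ∏ j : {j : Fin (2 ^ m) // 2 ^ m - n ≤ (j : ℕ)},
          W j.1 (Matrix.vecMul u (polarG m) j.1) (y j))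
    (i : Fin (2 ^ m)) (hi : (i : ℕ) < 2 ^ m - n) :
    CondIndepFun
      (MeasurableSpace.comap
        (fun ω : (Fin (2 ^ m) → ZMod 2) × ({j : Fin (2 ^ m) // 2 ^ m - n ≤ (j : ℕ)} → 𝒴) =>
          fun j : {j : Fin (2 ^ m) // j < i} => ω.1 j.1)
        inferInstance)
      (Measurable.comap_le (measurable_of_countable _))
      (fun ω => ω.1 i) (fun ω => ω.2) P := by
  set T : (Fin (2 ^ m) → ZMod 2) × ({j : Fin (2 ^ m) // 2 ^ m - n ≤ (j : ℕ)} → 𝒴) →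
      (Fin (2 ^ m) → ZMod 2) × ({j : Fin (2 ^ m) // 2 ^ m - n ≤ (j : ℕ)} → 𝒴) :=
    fun ω => (ω.1 + Pi.single i 1, ω.2) with hTdef
  have hTT : ∀ ω, T (T ω) = ω := by
    intro ω
    have h1 : (1 : ZMod 2) + 1 = 0 := by decide
    simp only [hTdef, add_assoc, ← Pi.single_add, h1, Pi.single_zero, add_zero]
  have hPT : ∀ ω, P {T ω} = P {ω} := by
    rintro ⟨u, y⟩
    simp only [hTdef]
    rw [hP, hP]
    congr 1
    refine Finset.prod_congr rfl fun j _ => ?_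
    have : polarG m i j.1 = 0 :=
      polarG_lower m i j.1 (Fin.lt_def.mpr (lt_of_lt_of_le hi j.2))
    rw [Matrix.add_vecMul, Pi.add_apply, Matrix.single_one_vecMul, Matrix.row_apply, this, add_zero]
  have hT : MeasurePreserving T P P := by
    refine ⟨measurable_of_countable _, ?_⟩
    refine Measure.ext_of_singleton fun ω => ?_
    rw [Measure.map_apply (measurable_of_countable _) (measurableSet_singleton _)]
    have : T ⁻¹' {ω} = {T ω} := by
      ext x
      simp only [Set.mem_preimage, Set.mem_singleton_iff]
      constructor
      · rintro rfl; exact (hTT x).symm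
      · rintro rfl; exact hTT ω
    rw [this, hPT]
  refine condIndepFun_of_joint _ P _ _ _ (measurable_of_countable _) (measurable_of_countable _) ?_
  rintro s t A hs ht ⟨B, hB, rfl⟩
  refine bit_indep P (fun ω => ω.1 i) (measurable_of_countable _) T hT ?_ s _
    (Set.Countable.measurableSet (Set.to_countable _)) ?_
  · intro ω; simp [hTdef]
  · ext ω
    simp only [Set.mem_preimage, Set.mem_inter_iff, hTdef, Pi.add_apply]
    have : (fun j : {j : Fin (2 ^ m) // j < i} =>
        ω.1 j.1 + (Pi.single i 1 : Fin (2 ^ m) → ZMod 2) j.1) =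
        fun j : {j : Fin (2 ^ m) // j < i} => ω.1 j.1 := by
      funext j
      rw [Pi.single_eq_of_ne (ne_of_lt j.2), add_zero]
    rw [this]
end
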